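/- (Observation 2: SDP infeasibility for n = 7) Define w : ℕ → ℝ by w 0 = 1, w 1 = w 2 = w 3 = 0, w 4 = 1/81, w 5 = 2/243, w 6 = 4/729, w 7 = 22/2187. There is no real symmetric positive semidefinite matrix Γ indexed by Pauli labels s : Fin 7 → Fin 4 satisfying all of: Γ 0 0 = 1 (where 0 is the all-zero label); Γ s 0 = Γ s s for every s; Γ s t = 0 whenever E_s and E_t anticommute; and Γ s s = w (wt s) for every s. -/

import Mathlib

open Matrix Kronecker ComplexOrder

/-- The four Pauli matrices `σ₀, σ₁, σ₂, σ₃`. -/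
def pauli : Fin 4 → Matrix (Fin 2) (Fin 2) ℂ :=
  ![!![1, 0; 0, 1], !![0, 1; 1, 0], !![0, -Complex.I; Complex.I, 0], !![1, 0; 0, -1]]

/-- The Pauli string `E_s`, `E_s x y = ∏_k (σ_{s k}) (x k) (y k)`. -/
def pauliString (n : ℕ) (s : Fin n → Fin 4) :
    Matrix (Fin n → Fin 2) (Fin n → Fin 2) ℂ :=
  Matrix.of fun x y => ∏ k, pauli (s k) (x k) (y k)

/-- The weight of a Pauli label: the number of non-identity tensor factors. -/
def wt {n : ℕ} (s : Fin n → Fin 4) : ℕ :=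
  (Finset.univ.filter fun k => s k ≠ 0).card

/-- The swap operator on `ℂ^{2^n} ⊗ ℂ^{2^n}`. -/
def swapN (n : ℕ) :
    Matrix ((Fin n → Fin 2) × (Fin n → Fin 2)) ((Fin n → Fin 2) × (Fin n → Fin 2)) ℂ :=
  Matrix.of fun p q => if p.1 = q.2 ∧ p.2 = q.1 then 1 else 0

/-- The diagonal weights derived from the `Φ_E8` correlations. -/
noncomputable def wFn : ℕ → ℝ
  | 0 => 1
  | 4 => 1 / 81
  | 5 => 2 / 243
  | 6 => 4 / 729
  | 7 => 22 / 2187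
  | _ => 0

namespace Cert

/-- Coefficient of `z ^ a` in `(1 + 6 z) ^ p * (1 - 3 z) ^ d`. -/
def ehat (a p d : ℕ) : ℤ :=
  ∑ x ∈ Finset.HasAntidiagonal.antidiagonal a, (6 ^ x.1 * (p.choose x.1 : ℤ)) * ((-3) ^ x.2 * (d.choose x.2 : ℤ))

/-- Sum of `F` over `n` sites, grouped by the joint zero pattern. -/
def tsum2 (n r q o : ℤ) (F : ℤ → ℤ → ℤ) : ℤ :=
  o * F 1 1 + (r - o) * F 1 0 + (q - o) * F 0 1 + (n - r - q + o) * F 0 0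

def lin (n r x : ℤ) : ℤ := n * x - r

def quad (n r x y : ℤ) : ℤ :=
  (n - 1) * (n - 2) * (x * y) - (n - 1) * (r - 1) * (x + y) + r * (r - 1)

/-- The Hahn-type kernels of degree `m = 0, 1, 2`, and the identity kernel for `m = 3`. -/
def qker (m : ℕ) (n r q o : ℤ) : ℤ :=
  match m with
  | 0 => 1
  | 1 => tsum2 n r q o fun x y => lin n r x * lin n q y
  | 2 => (tsum2 n r q o fun x y => tsum2 n r q o fun x' y' => quad n r x x' * quad n q y y')
      - tsum2 n r q o fun x y => quad n r x x * quad n q y y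
  | _ => if r = o ∧ q = o then 1 else 0

def coef (c : ℤ × ℤ × ℤ × ℤ × ℤ) (r : ℕ) : ℤ :=
  match r with
  | 0 => c.1
  | 1 => c.2.1
  | 2 => c.2.2.1
  | 3 => c.2.2.2.1
  | 7 => c.2.2.2.2
  | _ => 0

def blockVal (l : List (ℕ × ℤ × ℤ × ℤ × ℤ × ℤ)) (r q : ℕ) : ℤ :=
  (l.map fun e => (e.1 : ℤ) * (coef e.2 r * coef e.2 q)).sum

/-- The dual certificate: for each block `(a, m)` a list of weighted rank-one terms. The
coefficient tuple is indexed by the numbers `0, 1, 2, 3, 7` of identity factors. -/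
def certData : List (ℕ × ℕ × List (ℕ × ℤ × ℤ × ℤ × ℤ × ℤ)) := [
  (0, 0, [
    (1, -243531361, -228872487, -204410066, -132948027, 24999479815),
    (1, 72376331, -3028605, -31038284, -5822491, 0),
    (1, 0, 26880291, -12407800, -6608108, 0),
    (1, 0, 0, 3534102, -4153351, 0),
    (1, 0, 0, 0, 718226, 0),
    (4460220185, 1, 0, 0, 0, -1),
    (11536377105, 0, 1, 0, 0, 1),
    (62434152, -1, 1, 0, 0, 0),
    (2134375810, 0, 0, 1, 0, -1),
    (49235378, 1, 0, 1, 0, 0),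
    (81104562, 0, -1, 1, 0, 0),
    (10212712605, 0, 0, 0, 1, 1),
    (97515826, -1, 0, 0, 1, 0),
    (160953576, 0, -1, 0, 1, 0),
    (61485424, 0, 0, -1, 1, 0),
    (624951063880070, 0, 0, 0, 0, 1),
    (60032044577, 1, 0, 0, 0, 0),
    (41050826730, 0, 1, 0, 0, 0),
    (40620833810, 0, 0, 1, 0, 0),
    (7133629218, 0, 0, 0, 1, 0)]),
  (0, 1, [
    (1, 0, 19744587, 8984141, 4962160, 0),
    (1, 0, 0, 12260237, 15693071, 0),
    (1, 0, 0, 0, 293064, 0),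
    (7770033, 0, 1, 1, 0, 0),
    (1583280, 0, 1, 0, 1, 0),
    (3789453, 0, 0, 1, 1, 0),
    (38972783718, 0, 1, 0, 0, 0),
    (23093385424, 0, 0, 1, 0, 0),
    (27111577570, 0, 0, 0, 1, 0)]),
  (0, 2, [
    (1, 0, 0, 2187698, -94331, 0),
    (1, 0, 0, 0, 1048954, 0),
    (764234, 0, 0, -1, 1, 0),
    (4788771366, 0, 0, 1, 0, 0),
    (1108817873, 0, 0, 0, 1, 0)]),
  (0, 3, [
    (1, 0, 0, 0, 5156061, 0),
    (26608428279, 0, 0, 0, 1, 0)]),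
  (1, 0, [
    (1, 33983437, 26382850, 25509808, 36338562, 0),
    (1, 0, 19398744, 13773328, -15194296, 0),
    (1, 0, 0, 7674279, 17581638, 0),
    (1, 0, 0, 0, 543461, 0),
    (24089050, -1, 1, 0, 0, 0),
    (4426096, -1, 0, 1, 0, 0),
    (4829632, 0, -1, 1, 0, 0),
    (27391194, -1, 0, 0, 1, 0),
    (27368676, 0, -1, 0, 1, 0),
    (442730, 0, 0, -1, 1, 0),
    (115422395091, 1, 0, 0, 0, 0),
    (107173603806, 0, 1, 0, 0, 0),
    (89946559413, 0, 0, 1, 0, 0),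
    (186000151895, 0, 0, 0, 1, 0)]),
  (1, 1, [
    (1, 0, 3969854, -769339, 6141536, 0),
    (1, 0, 0, 7435525, -1582602, 0),
    (1, 0, 0, 0, 461974, 0),
    (1044694, 0, -1, 1, 0, 0),
    (4204144, 0, -1, 0, 1, 0),
    (3659746, 0, 0, -1, 1, 0),
    (15766827846, 0, 1, 0, 0, 0),
    (55927285664, 0, 0, 1, 0, 0),
    (40465444334, 0, 0, 0, 1, 0)]),
  (1, 2, [
    (1, 0, 0, 138412, 100427, 0),
    (1, 0, 0, 0, 45824, 0),
    (82031, 0, 0, -1, 1, 0),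
    (18962238, 0, 0, 1, 0, 0),
    (12110813, 0, 0, 0, 1, 0)]),
  (1, 3, [
    (1, 0, 0, 0, 1825566, 0),
    (3335834844, 0, 0, 0, 1, 0)]),
  (2, 0, [
    (1, 11169201, -4111038, 10673398, -1441080, 0),
    (1, 0, 14938329, -6452664, 7767431, 0),
    (1, 0, 0, 9638474, 10162510, 0),
    (1, 0, 0, 0, 46594, 0),
    (1987362, -1, 1, 0, 0, 0),
    (5437398, -1, 0, 1, 0, 0),
    (3421620, 0, -1, 1, 0, 0),
    (1037880, 1, 0, 0, 1, 0),
    (588801, 0, 1, 0, 1, 0),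
    (2249644, 0, 0, 1, 1, 0),
    (37424955759, 1, 0, 0, 0, 0),
    (72045379572, 0, 1, 0, 0, 0),
    (74542849842, 0, 0, 1, 0, 0),
    (49712640098, 0, 0, 0, 1, 0)]),
  (2, 1, [
    (1, 0, 2461897, 117720, -6799609, 0),
    (1, 0, 0, 741350, 3897098, 0),
    (1, 0, 0, 0, 293266, 0),
    (39960, 0, -1, 1, 0, 0),
    (375551, 0, -1, 0, 1, 0),
    (1321828, 0, 0, -1, 1, 0),
    (1818329688, 0, 1, 0, 0, 0),
    (167140096, 0, 0, 1, 0, 0),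
    (18460507716, 0, 0, 0, 1, 0)]),
  (2, 2, [
    (1, 0, 0, 2556318, -2543420, 0),
    (1, 0, 0, 0, 14890, 0),
    (231690, 0, 0, -1, 1, 0),
    (196848861, 0, 0, 1, 0, 0),
    (193302310, 0, 0, 0, 1, 0)]),
  (3, 0, [
    (1, 6438281, 306094, -5739942, 12114295, 0),
    (1, 0, 5167064, 9512451, -4228507, 0),
    (1, 0, 0, 232924, -128493, 0),
    (1, 0, 0, 0, 130822, 0),
    (447586, 1, 1, 0, 0, 0),
    (3694902, 1, 0, 1, 0, 0),
    (3371484, 0, 1, 1, 0, 0),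
    (3550895, -1, 0, 0, 1, 0),
    (583318, 0, 1, 0, 1, 0),
    (9012279, 0, 0, 1, 1, 0),
    (1232826056, 1, 0, 0, 0, 0),
    (804494480, 0, 1, 0, 0, 0),
    (3681024794, 0, 0, 1, 0, 0),
    (4921715301, 0, 0, 0, 1, 0)]),
  (3, 1, [
    (1, 0, 4022976, -2808572, 6582003, 0),
    (1, 0, 0, 5045715, 10181909, 0),
    (1, 0, 0, 0, 51748, 0),
    (1710222, 0, 1, 1, 0, 0),
    (2225628, 0, -1, 0, 1, 0),
    (1459869, 0, 0, -1, 1, 0),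
    (154066224, 0, 1, 0, 0, 0),
    (328230800, 0, 0, 1, 0, 0),
    (1469904259, 0, 0, 0, 1, 0)]),
  (3, 2, [
    (1, 0, 0, 16747, 0, 0),
    (278591, 0, 0, 1, 0, 0)]),
  (4, 0, [
    (1, 5539646, -1790586, 5555634, -17481259, 0),
    (1, 0, 6619141, 82370, -19358976, 0),
    (1, 0, 0, 50225, 7289, 0),
    (1, 0, 0, 0, 131592, 0),
    (2153844, -1, 1, 0, 0, 0),
    (2673636, 1, 0, 1, 0, 0),
    (569846, 0, -1, 1, 0, 0),
    (6478486, -1, 0, 0, 1, 0),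
    (6279042, 0, 1, 0, 1, 0),
    (6968899, 0, 0, -1, 1, 0),
    (299251918, 1, 0, 0, 0, 0),
    (462496791, 0, 1, 0, 0, 0),
    (300226138, 0, 0, 1, 0, 0),
    (6779316731, 0, 0, 0, 1, 0)]),
  (4, 1, [
    (1, 0, 2466382, 7479248, 0, 0),
    (1, 0, 0, 43676, 0, 0),
    (909664, 0, 1, 1, 0, 0),
    (60706012, 0, 1, 0, 0, 0),
    (556780656, 0, 0, 1, 0, 0)]),
  (5, 0, [
    (1, 3178493, 3159196, -9551093, 0, 0),
    (1, 0, 24477, 2840, 0, 0),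
    (1, 0, 0, 44560, 0, 0),
    (571628, -1, 1, 0, 0, 0),
    (2840351, -1, 0, 1, 0, 0),
    (3008948, 0, 1, 1, 0, 0),
    (98992972, 1, 0, 0, 0, 0),
    (93727879, 0, 1, 0, 0, 0),
    (911056052, 0, 0, 1, 0, 0)]),
  (5, 1, [
    (1, 0, 4655023, 0, 0, 0),
    (21691437071, 0, 1, 0, 0, 0)]),
  (6, 0, [
    (1, 2781104, -2675650, 0, 0, 0),
    (1, 0, 22591, 0, 0, 0),
    (24800, 1, 1, 0, 0, 0),
    (232428384, 1, 0, 0, 0, 0),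
    (214328219, 0, 1, 0, 0, 0)]),
  (7, 0, [
    (1, 10846, 0, 0, 0, 0),
    (121084, 1, 0, 0, 0, 0)])]

/-- Value of the dual matrix on a pair of labels with `r`, `q` zeros, `o` common zeros,
`d` disagreements and `p` nonzero agreements. -/
def yval (r q o d p : ℕ) : ℤ :=
  (certData.map fun b => ehat b.1 p d * qker b.2.1 ((7 : ℤ) - b.1) r q o * blockVal b.2.2 r q).sum

theorem yval_zero : ∀ (r q o : Fin 4) (d : Fin 8),
    (o.1 ≤ r.1 ∧ o.1 ≤ q.1 ∧ d.1 + r.1 + q.1 ≤ 7 + o.1 ∧ d.1 % 2 = 0 ∧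
      ¬ (r.1 = q.1 ∧ q.1 = o.1 ∧ d.1 = 0)) →
    yval r.1 q.1 o.1 d.1 (7 + o.1 - r.1 - q.1 - d.1) = 0 := by
  decide +kernel

theorem yval_neg : yval 7 7 7 0 0
    + 22 * (yval 0 0 0 0 7 + 2 * yval 7 0 0 0 0)
    + 28 * (yval 1 1 1 0 6 + 2 * yval 7 1 1 0 0)
    + 42 * (yval 2 2 2 0 5 + 2 * yval 7 2 2 0 0)
    + 35 * (yval 3 3 3 0 4 + 2 * yval 7 3 3 0 0) < 0 := by
  decide +kernel

/-! ### Statistics of labels -/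

abbrev Lab := Fin 7 → Fin 4

def nz (s : Lab) : ℕ := (Finset.univ.filter fun k => s k = 0).card

def ov (s t : Lab) : ℕ := (Finset.univ.filter fun k => s k = 0 ∧ t k = 0).card

def dis (s t : Lab) : ℕ := (Finset.univ.filter fun k => s k ≠ 0 ∧ t k ≠ 0 ∧ s k ≠ t k).card

def agr (s t : Lab) : ℕ := (Finset.univ.filter fun k => s k ≠ 0 ∧ s k = t k).card

def yker (s t : Lab) : ℤ := yval (nz s) (nz t) (ov s t) (dis s t) (agr s t)

/-- zero indicator -/
def xi (v : Fin 4) : ℤ := if v = 0 then 1 else 0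

/-- site functions -/
def hsite (c x : Fin 4) : ℤ :=
  if c = 0 then 1 else if x = 0 then 0 else if x = c then 2 else -1

def hprod (u s : Lab) : ℤ := ∏ k, hsite (u k) (s k)

theorem sum_xi (s : Lab) : ∑ k, xi (s k) = nz s := by
  simp [xi, nz]

theorem sum_xi_mul (s t : Lab) : ∑ k, xi (s k) * xi (t k) = ov s t := by
  simp only [xi, ov, Finset.card_filter]
  push_cast
  refine Finset.sum_congr rfl fun k _ => ?_
  by_cases h1 : s k = 0 <;> by_cases h2 : t k = 0 <;> simp [h1, h2]

theorem stats (s t : Lab) : agr s t + dis s t + nz s + nz t = 7 + ov s t := by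
  have h : ∀ x y : Fin 4, (if x ≠ 0 ∧ x = y then 1 else 0) +
      (if x ≠ 0 ∧ y ≠ 0 ∧ x ≠ y then 1 else 0) + (if x = 0 then 1 else 0)
      + (if y = 0 then 1 else 0) = 1 + (if x = 0 ∧ y = 0 then 1 else 0) := by decide
  have key := Finset.sum_congr rfl fun k (_ : k ∈ (Finset.univ : Finset (Fin 7))) => h (s k) (t k)
  simp only [Finset.sum_add_distrib, Finset.sum_const, Finset.card_univ, Fintype.card_fin,
    smul_eq_mul, mul_one] at key
  simp only [agr, dis, nz, ov, Finset.card_filter]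
  exact key

theorem nz_add_wt (s : Lab) : nz s + wt s = 7 := by
  have := Finset.card_filter_add_card_filter_not (s := (Finset.univ : Finset (Fin 7)))
    (fun k => s k = 0)
  simpa [nz, wt] using this

theorem ov_le_left (s t : Lab) : ov s t ≤ nz s :=
  Finset.card_le_card fun k => by simp; tauto

theorem ov_le_right (s t : Lab) : ov s t ≤ nz t :=
  Finset.card_le_card fun k => by simp

/-! ### Generating functions -/

open Polynomial in
theorem coeff_lin_pow (c : ℤ) (p i : ℕ) :
    ((1 + C c * X : ℤ[X]) ^ p).coeff i = c ^ i * (p.choose i : ℤ) := by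
  have h : (1 + C c * X : ℤ[X]) ^ p = ((1 + X : ℤ[X]) ^ p).comp (C c * X) := by simp
  rw [h, comp_C_mul_X_coeff, coeff_one_add_X_pow]
  ring

open Polynomial in
/-- Weight-graded sum of product functions. -/
theorem graded_sum (g : Fin 7 → Fin 4 → ℤ) (hg : ∀ k, g k 0 = 1) (a : ℕ) :
    ∑ u ∈ (Finset.univ : Finset Lab).filter (fun u => wt u = a), ∏ k, g k (u k)
      = (∏ k, (1 + C (g k 1 + g k 2 + g k 3) * X : ℤ[X])).coeff a := by
  have h1 : (∏ k, (1 + C (g k 1 + g k 2 + g k 3) * X : ℤ[X]))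
      = ∏ k, ∑ c : Fin 4, C (g k c) * X ^ (if c ≠ 0 then 1 else 0) := by
    refine Finset.prod_congr rfl fun k _ => ?_
    simp [Fin.sum_univ_four, hg]
    ring
  have h2 : ∏ k, ∑ c : Fin 4, (C (g k c) * X ^ (if c ≠ 0 then 1 else 0) : ℤ[X])
      = ∑ u : Lab, C (∏ k, g k (u k)) * X ^ (wt u) := by
    rw [Finset.prod_univ_sum]
    simp only [Fintype.piFinset_univ]
    refine Finset.sum_congr rfl fun u _ => ?_
    rw [Finset.prod_mul_distrib, Finset.prod_pow_eq_pow_sum, map_prod, wt, Finset.card_filter]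
  rw [h1, h2, finsetSum_coeff, Finset.sum_filter]
  refine Finset.sum_congr rfl fun u _ => ?_
  rw [coeff_C_mul_X_pow]
  simp [eq_comm]

theorem hsite_sum : ∀ x y : Fin 4, hsite 1 x * hsite 1 y + hsite 2 x * hsite 2 y
    + hsite 3 x * hsite 3 y = if x ≠ 0 ∧ x = y then 6 else
      if x ≠ 0 ∧ y ≠ 0 ∧ x ≠ y then -3 else 0 := by decide

open Polynomial in
theorem hprod_sum (s t : Lab) (a : ℕ) :
    ∑ u ∈ (Finset.univ : Finset Lab).filter (fun u => wt u = a), hprod u s * hprod u t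
      = ehat a (agr s t) (dis s t) := by
  have h := graded_sum (fun k c => hsite c (s k) * hsite c (t k)) (fun k => by simp [hsite]) a
  simp only [Finset.prod_mul_distrib] at h
  simp only [hprod]
  rw [h]
  simp only [hsite_sum]
  have h3 : (∏ k, (1 + C (if s k ≠ 0 ∧ s k = t k then 6 else
      if s k ≠ 0 ∧ t k ≠ 0 ∧ s k ≠ t k then -3 else 0) * X : ℤ[X]))
      = (1 + C 6 * X) ^ (agr s t) * (1 + C (-3) * X) ^ (dis s t) := by
    rw [agr, dis, ← Finset.prod_const, ← Finset.prod_const, Finset.prod_filter,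
      Finset.prod_filter, ← Finset.prod_mul_distrib]
    refine Finset.prod_congr rfl fun k _ => ?_
    by_cases h1 : s k ≠ 0 ∧ s k = t k
    · have h2 : ¬ (s k ≠ 0 ∧ t k ≠ 0 ∧ s k ≠ t k) := by tauto
      rw [if_pos h1, if_pos h1, if_neg h2, mul_one]
    · by_cases h2 : s k ≠ 0 ∧ t k ≠ 0 ∧ s k ≠ t k
      · rw [if_neg h1, if_neg h1, if_pos h2, if_pos h2, one_mul]
      · rw [if_neg h1, if_neg h1, if_neg h2, if_neg h2]; simp
  rw [h3, coeff_mul]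
  simp only [coeff_lin_pow]
  rfl

open Polynomial in
theorem card_wt (a : ℕ) : ((Finset.univ : Finset Lab).filter (fun u => wt u = a)).card
    = 3 ^ a * Nat.choose 7 a := by
  have h := graded_sum (fun _ _ => 1) (fun _ => rfl) a
  simp only [Finset.prod_const_one, Finset.sum_const, Finset.prod_const, Finset.card_univ,
    Fintype.card_fin, coeff_lin_pow] at h
  norm_num at h
  exact_mod_cast h

/-! ### Sums over sites outside the support of `u` -/

theorem hprod_ne (u s : Lab) (h : hprod u s ≠ 0) (k : Fin 7) (hk : u k ≠ 0) : s k ≠ 0 := by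
  intro hs
  apply h
  exact Finset.prod_eq_zero (Finset.mem_univ k) (by simp [hsite, hk, hs])

theorem sum_sites (u s t : Lab) (hs : hprod u s ≠ 0) (ht : hprod u t ≠ 0) (F : ℤ → ℤ → ℤ) :
    ∑ k, xi (u k) * F (xi (s k)) (xi (t k))
      = tsum2 ((7 : ℤ) - wt u) (nz s) (nz t) (ov s t) F := by
  have hpt : ∀ k, xi (u k) * F (xi (s k)) (xi (t k))
      = xi (s k) * xi (t k) * F 1 1 + (xi (s k) - xi (s k) * xi (t k)) * F 1 0
        + (xi (t k) - xi (s k) * xi (t k)) * F 0 1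
        + (xi (u k) - xi (s k) - xi (t k) + xi (s k) * xi (t k)) * F 0 0 := by
    intro k
    by_cases hu : u k = 0
    · by_cases h1 : s k = 0 <;> by_cases h2 : t k = 0 <;> simp [xi, hu, h1, h2]
    · have h1 := hprod_ne u s hs k hu
      have h2 := hprod_ne u t ht k hu
      simp [xi, hu, h1, h2]
  have hu : (nz u : ℤ) = 7 - wt u := by
    have := nz_add_wt u
    omega
  simp only [hpt, Finset.sum_add_distrib, ← Finset.sum_mul, Finset.sum_sub_distrib, sum_xi,
    sum_xi_mul, tsum2, hu]

/-! ### Positive kernels -/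

/-- Kernels that pair nonnegatively with a fixed positive semidefinite matrix. -/
def PosK (Γ : Matrix Lab Lab ℝ) (K : Lab → Lab → ℤ) : Prop :=
  0 ≤ ∑ s, ∑ t, Γ s t * (K s t : ℝ)

variable {Γ : Matrix Lab Lab ℝ}

theorem posK_rank_one (hΓ : Γ.PosSemidef) (f : Lab → ℤ) : PosK Γ fun s t => f s * f t := by
  have h := hΓ.dotProduct_mulVec_nonneg (fun s => (f s : ℝ))
  have e : ∑ s, ∑ t, Γ s t * ((f s * f t : ℤ) : ℝ)
      = star (fun s => (f s : ℝ)) ⬝ᵥ (Γ *ᵥ fun s => (f s : ℝ)) := by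
    simp only [dotProduct, mulVec, Finset.mul_sum]
    refine Finset.sum_congr rfl fun s _ => Finset.sum_congr rfl fun t _ => ?_
    simp
    ring
  unfold PosK
  rw [e]
  exact h

theorem posK_add {K L : Lab → Lab → ℤ} (hK : PosK Γ K) (hL : PosK Γ L) :
    PosK Γ fun s t => K s t + L s t := by
  unfold PosK at *
  simp only [Int.cast_add, mul_add, Finset.sum_add_distrib]
  exact add_nonneg hK hL

theorem posK_zero : PosK Γ fun _ _ => 0 := by
  simp [PosK]

theorem posK_nsmul {K : Lab → Lab → ℤ} (hK : PosK Γ K) (w : ℕ) :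
    PosK Γ fun s t => (w : ℤ) * K s t := by
  induction w with
  | zero => simpa using posK_zero
  | succ n ih =>
    have := posK_add ih hK
    convert this using 3
    push_cast
    ring

theorem posK_sum {ι : Type} (A : Finset ι) (K : ι → Lab → Lab → ℤ)
    (h : ∀ i ∈ A, PosK Γ (K i)) : PosK Γ fun s t => ∑ i ∈ A, K i s t := by
  classical
  induction A using Finset.induction_on with
  | empty => simpa using posK_zero
  | insert i A hi ih =>
    simp only [Finset.sum_insert hi]
    exact posK_add (h i (by simp)) (ih fun j hj => h j (by simp [hj]))

theorem posK_list {α : Type} (l : List α) (K : α → Lab → Lab → ℤ)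
    (h : ∀ e, PosK Γ (K e)) : PosK Γ fun s t => (l.map fun e => K e s t).sum := by
  induction l with
  | nil => simpa using posK_zero
  | cons e l ih =>
    simp only [List.map_cons, List.sum_cons]
    exact posK_add (h e) ih

def zset (s : Lab) : Finset (Fin 7) := Finset.univ.filter fun k => s k = 0

theorem zset_eq_iff (s t : Lab) :
    zset s = zset t ↔ ((nz s : ℤ) = ov s t ∧ (nz t : ℤ) = ov s t) := by
  have hs : nz s = (zset s).card := rfl
  have ht : nz t = (zset t).card := rfl
  have ho : ov s t = (zset s ∩ zset t).card := by
    rw [ov, zset, zset, ← Finset.filter_and]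
  rw [hs, ht, ho]
  constructor
  · intro h
    simp [h]
  · rintro ⟨h1, h2⟩
    have e1 : zset s ∩ zset t = zset s :=
      Finset.eq_of_subset_of_card_le Finset.inter_subset_left (by omega)
    have e2 : zset s ∩ zset t = zset t :=
      Finset.eq_of_subset_of_card_le Finset.inter_subset_right (by omega)
    rw [← e1, e2]

theorem posK_u (hΓ : Γ.PosSemidef) (m : ℕ) (f : Lab → ℤ) (u : Lab) :
    PosK Γ fun s t => hprod u s * hprod u t
      * qker m ((7 : ℤ) - wt u) (nz s) (nz t) (ov s t) * (f s * f t) := by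
  match m with
  | 0 =>
    convert posK_rank_one hΓ (fun s => hprod u s * f s) using 3
    simp only [qker]; ring
  | 1 =>
    have := posK_sum (Γ := Γ) Finset.univ
      (fun k s t => (xi (u k) * hprod u s * f s * lin ((7 : ℤ) - wt u) (nz s) (xi (s k)))
        * (xi (u k) * hprod u t * f t * lin ((7 : ℤ) - wt u) (nz t) (xi (t k))))
      (fun k _ => posK_rank_one hΓ
        (fun s => xi (u k) * hprod u s * f s * lin ((7 : ℤ) - wt u) (nz s) (xi (s k))))
    convert this using 3 with s t
    by_cases hs : hprod u s = 0
    · simp [hs]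
    by_cases ht : hprod u t = 0
    · simp [ht]
    simp only [qker]
    rw [← sum_sites u s t hs ht, Finset.mul_sum, Finset.sum_mul]
    refine Finset.sum_congr rfl fun k _ => ?_
    have hx : xi (u k) = xi (u k) * xi (u k) := by unfold xi; split_ifs <;> simp
    conv_lhs => rw [hx]
    ring
  | 2 =>
    set N : ℤ := (7 : ℤ) - wt u with hN
    have := posK_sum (Γ := Γ) (Finset.univ ×ˢ Finset.univ : Finset (Fin 7 × Fin 7))
      (fun kl s t => ((if kl.1 = kl.2 then 0 else 1) * xi (u kl.1) * xi (u kl.2) * hprod u s * f s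
          * quad N (nz s) (xi (s kl.1)) (xi (s kl.2)))
        * ((if kl.1 = kl.2 then 0 else 1) * xi (u kl.1) * xi (u kl.2) * hprod u t * f t
          * quad N (nz t) (xi (t kl.1)) (xi (t kl.2))))
      (fun kl _ => posK_rank_one hΓ
        (fun s => (if kl.1 = kl.2 then 0 else 1) * xi (u kl.1) * xi (u kl.2) * hprod u s * f s
          * quad N (nz s) (xi (s kl.1)) (xi (s kl.2))))
    convert this using 3 with s t
    by_cases hs : hprod u s = 0
    · simp [hs]
    by_cases ht : hprod u t = 0
    · simp [ht]
    simp only [qker]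
    have hss := sum_sites u s t hs ht
    rw [← hN] at hss
    rw [← hss, ← hss, Finset.sum_product]
    have hx : ∀ k, xi (u k) * xi (u k) = xi (u k) := by
      intro k; unfold xi; split_ifs <;> simp
    have hd : ∀ G : Fin 7 → ℤ, ∑ k, G k = ∑ k, ∑ l, if k = l then G k else 0 := by
      intro G; simp
    rw [hd (fun k => xi (u k) * (quad N (nz s) (xi (s k)) (xi (s k))
      * quad N (nz t) (xi (t k)) (xi (t k))))]
    rw [← Finset.sum_sub_distrib, Finset.mul_sum, Finset.sum_mul]
    refine Finset.sum_congr rfl fun k _ => ?_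
    rw [← hss, Finset.mul_sum, ← Finset.sum_sub_distrib, Finset.mul_sum, Finset.sum_mul]
    refine Finset.sum_congr rfl fun l _ => ?_
    have h1 := hx k
    have h2 := hx l
    by_cases hkl : k = l
    · subst hkl
      simp only [if_true]
      linear_combination (hprod u s * hprod u t * f s * f t
        * quad N (nz s) (xi (s k)) (xi (s k)) * quad N (nz t) (xi (t k)) (xi (t k))) * h1
    · simp only [hkl, if_false]
      linear_combination (-(hprod u s * hprod u t * f s * f t
        * quad N (nz s) (xi (s k)) (xi (s l)) * quad N (nz t) (xi (t k)) (xi (t l))))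
        * (h1 * xi (u l) * xi (u l) + h2 * xi (u k))
  | m + 3 =>
    have := posK_sum (Γ := Γ) (Finset.univ : Finset (Finset (Fin 7)))
      (fun B s t => (hprod u s * f s * (if zset s = B then 1 else 0))
        * (hprod u t * f t * (if zset t = B then 1 else 0)))
      (fun B _ => posK_rank_one hΓ (fun s => hprod u s * f s * (if zset s = B then 1 else 0)))
    convert this using 3 with s t
    have hq : qker (m + 3) ((7 : ℤ) - wt u) (nz s) (nz t) (ov s t)
        = if zset s = zset t then 1 else 0 := by
      simp only [zset_eq_iff]; rfl
    rw [hq, Finset.sum_eq_single (zset s)]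
    · by_cases h : zset s = zset t
      · simp [h]; ring
      · simp [h, Ne.symm h]
    · intro B _ hB
      simp [Ne.symm hB]
    · simp

theorem posK_block (hΓ : Γ.PosSemidef) (a m : ℕ) (f : Lab → ℤ) :
    PosK Γ fun s t => ehat a (agr s t) (dis s t)
      * qker m ((7 : ℤ) - a) (nz s) (nz t) (ov s t) * (f s * f t) := by
  have := posK_sum (Γ := Γ) ((Finset.univ : Finset Lab).filter (fun u => wt u = a)) _
    (fun u _ => posK_u hΓ m f u)
  convert this using 3 with s t
  rw [← hprod_sum, Finset.sum_mul, Finset.sum_mul]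
  refine Finset.sum_congr rfl fun u hu => ?_
  rw [(Finset.mem_filter.mp hu).2]

theorem posK_blockVal (hΓ : Γ.PosSemidef) (a m : ℕ) (l : List (ℕ × ℤ × ℤ × ℤ × ℤ × ℤ)) :
    PosK Γ fun s t => ehat a (agr s t) (dis s t)
      * qker m ((7 : ℤ) - a) (nz s) (nz t) (ov s t) * blockVal l (nz s) (nz t) := by
  have := posK_list (Γ := Γ) l
    (fun e s t => (e.1 : ℤ) * (ehat a (agr s t) (dis s t)
      * qker m ((7 : ℤ) - a) (nz s) (nz t) (ov s t) * (coef e.2 (nz s) * coef e.2 (nz t))))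
    (fun e => posK_nsmul (posK_block hΓ a m fun s => coef e.2 (nz s)) e.1)
  convert this using 3 with s t
  rw [blockVal, ← List.sum_map_mul_left]
  congr 1
  refine List.map_congr_left fun e _ => ?_
  ring

theorem posK_gen (hΓ : Γ.PosSemidef) (l : List (ℕ × ℕ × List (ℕ × ℤ × ℤ × ℤ × ℤ × ℤ))) :
    PosK Γ fun s t => (l.map fun b => ehat b.1 (agr s t) (dis s t)
      * qker b.2.1 ((7 : ℤ) - b.1) (nz s) (nz t) (ov s t) * blockVal b.2.2 (nz s) (nz t)).sum :=
  posK_list l (fun b s t => ehat b.1 (agr s t) (dis s t)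
      * qker b.2.1 ((7 : ℤ) - b.1) (nz s) (nz t) (ov s t) * blockVal b.2.2 (nz s) (nz t))
    fun b => posK_blockVal hΓ b.1 b.2.1 b.2.2

theorem posK_yker (hΓ : Γ.PosSemidef) : PosK Γ fun s t => yker s t := by
  have h := posK_gen hΓ certData
  unfold yker yval
  exact h

/-! ### Commutation of Pauli strings -/

def sgn (x y : Fin 4) : ℂ := if x ≠ 0 ∧ y ≠ 0 ∧ x ≠ y then -1 else 1

theorem pauli_comm (x y : Fin 4) : pauli x * pauli y = sgn x y • (pauli y * pauli x) := by
  ext i j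
  fin_cases x <;> fin_cases y <;> fin_cases i <;> fin_cases j <;>
    simp [pauli, sgn, Matrix.mul_apply, Fin.sum_univ_two]

theorem pauliString_mul (s t : Lab) (x y : Fin 7 → Fin 2) :
    (pauliString 7 s * pauliString 7 t) x y = ∏ k, (pauli (s k) * pauli (t k)) (x k) (y k) := by
  simp only [Matrix.mul_apply, pauliString, Matrix.of_apply, ← Finset.prod_mul_distrib]
  rw [Finset.prod_univ_sum]
  simp

theorem anticomm (s t : Lab) (h : dis s t % 2 = 1) :
    pauliString 7 s * pauliString 7 t = -(pauliString 7 t * pauliString 7 s) := by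
  ext x y
  rw [Matrix.neg_apply, pauliString_mul, pauliString_mul]
  have hp : ∏ k, sgn (s k) (t k) = -1 := by
    simp only [sgn]
    rw [← Finset.prod_filter, Finset.prod_const]
    exact Odd.neg_one_pow (Nat.odd_iff.mpr h)
  simp only [pauli_comm (s _) (t _), Matrix.smul_apply, smul_eq_mul, Finset.prod_mul_distrib, hp]
  ring

/-! ### Vanishing of the dual matrix -/

theorem coef_eq_zero (c) (r : ℕ) (h : 4 ≤ r) (h' : r < 7) : coef c r = 0 := by
  interval_cases r <;> rfl

theorem yval_coef_left (r q o d p : ℕ) (h : 4 ≤ r) (h' : r < 7) : yval r q o d p = 0 := by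
  simp [yval, blockVal, coef_eq_zero _ r h h']

theorem yval_coef_right (r q o d p : ℕ) (h : 4 ≤ q) (h' : q < 7) : yval r q o d p = 0 := by
  simp [yval, blockVal, coef_eq_zero _ q h h']

theorem eq_of_stats (s t : Lab) (h1 : nz s = ov s t) (h2 : nz t = ov s t) (h3 : dis s t = 0) :
    s = t := by
  have hz : zset s = zset t := (zset_eq_iff s t).2 ⟨by exact_mod_cast h1, by exact_mod_cast h2⟩
  funext k
  have hk : s k = 0 ↔ t k = 0 := by
    have : k ∈ zset s ↔ k ∈ zset t := by rw [hz]
    simpa [zset] using this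
  rw [dis, Finset.card_eq_zero, Finset.filter_eq_empty_iff] at h3
  have := h3 (Finset.mem_univ k)
  by_cases h0 : s k = 0
  · rw [h0, hk.1 h0]
  · by_contra hne
    exact this ⟨h0, fun h => h0 (hk.2 h), hne⟩

theorem nz_lt (s : Lab) (h : s ≠ 0) : nz s < 7 := by
  by_contra hc
  apply h
  have h1 := nz_add_wt s
  have h2 : wt s = 0 := by omega
  rw [wt, Finset.card_eq_zero, Finset.filter_eq_empty_iff] at h2
  funext k
  have := h2 (Finset.mem_univ k)
  simpa using this

theorem yker_zero (s t : Lab) (hs : s ≠ 0) (ht : t ≠ 0) (hst : s ≠ t) (hd : dis s t % 2 ≠ 1) :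
    yker s t = 0 := by
  have h1 := nz_lt s hs
  have h2 := nz_lt t ht
  have h3 := stats s t
  have h4 := ov_le_left s t
  have h5 := ov_le_right s t
  unfold yker
  by_cases hr : 4 ≤ nz s
  · exact yval_coef_left _ _ _ _ _ hr h1
  by_cases hq : 4 ≤ nz t
  · exact yval_coef_right _ _ _ _ _ hq h2
  have key := yval_zero ⟨nz s, by omega⟩ ⟨nz t, by omega⟩ ⟨ov s t, by omega⟩ ⟨dis s t, by omega⟩
    ⟨h4, h5, by simp only; omega, by simp only; omega, by
      rintro ⟨e1, e2, e3⟩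
      simp only at e1 e2 e3
      exact hst (eq_of_stats s t (by omega) e2 e3)⟩
  have hp : agr s t = 7 + ov s t - nz s - nz t - dis s t := by omega
  rw [hp]
  exact key

theorem nz_zero : nz 0 = 7 := by simp [nz]

theorem ov_self (s : Lab) : ov s s = nz s := by simp [ov, nz]

theorem dis_self (s : Lab) : dis s s = 0 := by simp [dis]

theorem yker_self (s : Lab) : yker s s = yval (7 - wt s) (7 - wt s) (7 - wt s) 0 (wt s) := by
  have h := nz_add_wt s
  have h' := stats s s
  rw [ov_self, dis_self] at h'
  have e1 : nz s = 7 - wt s := by omega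
  have e2 : agr s s = wt s := by omega
  rw [yker, ov_self, dis_self, e1, e2]

theorem yker_left (s : Lab) : yker 0 s = yval 7 (7 - wt s) (7 - wt s) 0 0 := by
  have h := nz_add_wt s
  have h' := stats 0 s
  have e0 : ov 0 s = nz s := by simp [ov, nz]
  rw [nz_zero, e0] at h'
  have e1 : nz s = 7 - wt s := by omega
  rw [yker, nz_zero, e0, e1, show dis 0 s = 0 by omega, show agr 0 s = 0 by omega]

theorem yker_right (s : Lab) : yker s 0 = yval (7 - wt s) 7 (7 - wt s) 0 0 := by
  have h := nz_add_wt s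
  have h' := stats s 0
  have e0 : ov s 0 = nz s := by simp [ov, nz]
  rw [nz_zero, e0] at h'
  have e1 : nz s = 7 - wt s := by omega
  rw [yker, nz_zero, e0, e1, show dis s 0 = 0 by omega, show agr s 0 = 0 by omega]

theorem yval_symm7 : ∀ r : Fin 8, yval r.1 7 r.1 0 0 = yval 7 r.1 r.1 0 0 := by decide +kernel

theorem wt_le (s : Lab) : wt s ≤ 7 := by
  have := nz_add_wt s
  omega

theorem sum_wt (F : ℕ → ℝ) : ∑ s : Lab, F (wt s)
    = ∑ a ∈ Finset.range 8, (3 ^ a * Nat.choose 7 a : ℕ) * F a := by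
  rw [← Finset.sum_fiberwise_of_maps_to (s := Finset.univ) (t := Finset.range 8) (g := wt)
    (fun s _ => by simpa using Nat.lt_succ_of_le (wt_le s))]
  refine Finset.sum_congr rfl fun a _ => ?_
  rw [← card_wt, ← nsmul_eq_mul, ← Finset.sum_const]
  refine Finset.sum_congr rfl fun s hs => ?_
  rw [(Finset.mem_filter.mp hs).2]

theorem main (hΓ : Γ.PosSemidef) (hsym : Γ.IsSymm) (h0 : ∀ s, Γ s 0 = Γ s s)
    (hac : ∀ s t, pauliString 7 s * pauliString 7 t = -(pauliString 7 t * pauliString 7 s) →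
        Γ s t = 0) (hw : ∀ s, Γ s s = wFn (wt s)) : False := by
  have hpos := posK_yker hΓ
  unfold PosK at hpos
  have hpt : ∀ s t, Γ s t * (yker s t : ℝ)
      = (if s = t then wFn (wt s) * (yker s s : ℝ) else 0)
      + (if s = 0 then (if t = 0 then 0 else wFn (wt t) * (yker 0 t : ℝ)) else 0)
      + (if t = 0 then (if s = 0 then 0 else wFn (wt s) * (yker 0 s : ℝ)) else 0) := by
    intro s t
    by_cases hst : s = t
    · subst hst
      by_cases hs : s = 0 <;> simp [hs, hw]
    by_cases hs : s = 0
    · subst hs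
      have ht : t ≠ 0 := fun h => hst h.symm
      have e : Γ 0 t = wFn (wt t) := by rw [← hsym.apply, h0, hw]
      simp [hst, ht, e]
    by_cases ht : t = 0
    · subst ht
      have e : yker s 0 = yker 0 s := by
        rw [yker_left, yker_right]
        exact yval_symm7 ⟨7 - wt s, by omega⟩
      simp [hst, h0, hw, e]
    simp only [hst, hs, ht, if_false, add_zero]
    by_cases hd : dis s t % 2 = 1
    · rw [hac s t (anticomm s t hd), zero_mul]
    · rw [yker_zero s t hs ht hst hd]; simp
  simp only [hpt, Finset.sum_add_distrib] at hpos
  have e1 : ∑ s : Lab, ∑ t : Lab, (if s = t then wFn (wt s) * (yker s s : ℝ) else 0)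
      = ∑ s : Lab, wFn (wt s) * (yval (7 - wt s) (7 - wt s) (7 - wt s) 0 (wt s) : ℝ) := by
    refine Finset.sum_congr rfl fun s _ => ?_
    rw [Finset.sum_ite_eq, if_pos (Finset.mem_univ _), yker_self]
  have hwt : ∀ s : Lab, wt s = 0 ↔ s = 0 := by
    intro s
    have h1 := nz_add_wt s
    constructor
    · intro h
      by_contra hs
      have := nz_lt s hs
      omega
    · rintro rfl
      simp [wt]
  have e2 : ∑ s : Lab, ∑ t : Lab,
      (if s = 0 then (if t = 0 then 0 else wFn (wt t) * (yker 0 t : ℝ)) else 0)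
      = ∑ t : Lab, (fun a : ℕ => if a = 0 then 0 else
        wFn a * (yval 7 (7 - a) (7 - a) 0 0 : ℝ)) (wt t) := by
    rw [Finset.sum_comm]
    refine Finset.sum_congr rfl fun t _ => ?_
    rw [Finset.sum_ite_eq', if_pos (Finset.mem_univ _), yker_left]
    simp only [hwt]
  have e3 : ∑ s : Lab, ∑ t : Lab,
      (if t = 0 then (if s = 0 then 0 else wFn (wt s) * (yker 0 s : ℝ)) else 0)
      = ∑ t : Lab, (fun a : ℕ => if a = 0 then 0 else
        wFn a * (yval 7 (7 - a) (7 - a) 0 0 : ℝ)) (wt t) := by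
    refine Finset.sum_congr rfl fun t _ => ?_
    rw [Finset.sum_ite_eq', if_pos (Finset.mem_univ _), yker_left]
    simp only [hwt]
  rw [e1, e2, e3, sum_wt (fun a => if a = 0 then 0 else
    wFn a * (yval 7 (7 - a) (7 - a) 0 0 : ℝ)), sum_wt (fun a => wFn a * (yval (7 - a) (7 - a) (7 - a) 0 a : ℝ))] at hpos
  have hneg : ((yval 7 7 7 0 0
    + 22 * (yval 0 0 0 0 7 + 2 * yval 7 0 0 0 0)
    + 28 * (yval 1 1 1 0 6 + 2 * yval 7 1 1 0 0)
    + 42 * (yval 2 2 2 0 5 + 2 * yval 7 2 2 0 0)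
    + 35 * (yval 3 3 3 0 4 + 2 * yval 7 3 3 0 0) : ℤ) : ℝ) < 0 := by
    exact_mod_cast yval_neg
  push_cast at hneg
  simp [Finset.sum_range_succ, wFn, Nat.choose] at hpos
  linarith

end Cert

/-- Observation 2: the moment-matrix SDP for `n = 7` with the `Φ_E8` diagonal is
infeasible. -/
theorem stmt12 :
    ¬ ∃ Γ : Matrix (Fin 7 → Fin 4) (Fin 7 → Fin 4) ℝ,
      Γ.IsSymm ∧ Γ.PosSemidef ∧
      Γ 0 0 = 1 ∧
      (∀ s, Γ s 0 = Γ s s) ∧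
      (∀ s t, pauliString 7 s * pauliString 7 t = -(pauliString 7 t * pauliString 7 s) →
        Γ s t = 0) ∧
      (∀ s, Γ s s = wFn (wt s)) := by
  rintro ⟨Γ, hsym, hΓ, -, h0, hac, hw⟩
  exact Cert.main hΓ hsym h0 hac hw
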